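/- For every bilocal model, setting I = ⟨(a¹_0 + a¹_1)/2 · a²_0 · (a³_0 + a³_1)/2⟩ and J = ⟨(a¹_0 − a¹_1)/2 · a²_1 · (a³_0 − a³_1)/2⟩, at least one of the following holds: there exists q ∈ (0,1) with I/q + J/(1−q) ≤ 1; or J = 0 and I ≤ 1; or I = 0 and J ≤ 1. -/

import Mathlib

open MeasureTheory

/-- A correlator of two independent single-source factors, modulated by a factor of absolute
value at most one, is bounded by the product of the first absolute moments. -/
lemma abs_integral_prod_mul_le {α β : Type*} [MeasurableSpace α] [MeasurableSpace β]
    {μ : Measure α} {ν : Measure β} [SFinite μ] [SFinite ν]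
    {f : α → ℝ} {g : β → ℝ} {b : α → β → ℝ} (hf : Integrable f μ) (hg : Integrable g ν)
    (hb : ∀ x y, |b x y| ≤ 1) :
    |∫ p, f p.1 * b p.1 p.2 * g p.2 ∂(μ.prod ν)| ≤ (∫ x, |f x| ∂μ) * ∫ y, |g y| ∂ν := by
  rw [← integral_prod_mul (fun x => |f x|) (fun y => |g y|), ← Real.norm_eq_abs]
  refine norm_integral_le_of_norm_le (hf.abs.mul_prod hg.abs) (ae_of_all _ fun p => ?_)
  rw [Real.norm_eq_abs, abs_mul, abs_mul]
  gcongr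
  exact mul_le_of_le_one_right (abs_nonneg _) (hb _ _)

/-- The half-sum and half-difference of two measurable `±1`-valued functions are integrable,
and their first absolute moments add up to one. -/
lemma integrable_half_add_sub_of_sign {α : Type*} [MeasurableSpace α]
    {μ : Measure α} [IsProbabilityMeasure μ] {u v : α → ℝ} (hu : Measurable u)
    (hv : Measurable v) (hu_val : ∀ x, u x = 1 ∨ u x = -1) (hv_val : ∀ x, v x = 1 ∨ v x = -1) :
    Integrable (fun x => (u x + v x) / 2) μ ∧ Integrable (fun x => (u x - v x) / 2) μ ∧
      (∫ x, |(u x + v x) / 2| ∂μ) + (∫ x, |(u x - v x) / 2| ∂μ) = 1 := by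
  have hu_int : Integrable u μ := .of_bound hu.aestronglyMeasurable 1 <|
    ae_of_all _ fun x => by rcases hu_val x with h | h <;> simp [h]
  have hv_int : Integrable v μ := .of_bound hv.aestronglyMeasurable 1 <|
    ae_of_all _ fun x => by rcases hv_val x with h | h <;> simp [h]
  have hadd : Integrable (fun x => (u x + v x) / 2) μ := (hu_int.add hv_int).div_const 2
  have hsub : Integrable (fun x => (u x - v x) / 2) μ := (hu_int.sub hv_int).div_const 2
  refine ⟨hadd, hsub, ?_⟩
  have hone : ∀ x, |(u x + v x) / 2| + |(u x - v x) / 2| = 1 := fun x => by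
    rcases hu_val x with h | h <;> rcases hv_val x with h' | h' <;> norm_num [h, h']
  rw [← integral_add hadd.abs hsub.abs]
  simp [hone]

/-- For every bilocal model (independent sources `(Λ₁,ρ₁)`, `(Λ₂,ρ₂)` with measurable
±1-valued responses `a¹ : {0,1}×Λ₁ → {−1,1}`, `a² : {0,1}×Λ₁×Λ₂ → {−1,1}`,
`a³ : {0,1}×Λ₂ → {−1,1}`), setting
`I = ⟨(a¹_0+a¹_1)/2 · a²_0 · (a³_0+a³_1)/2⟩` and `J = ⟨(a¹_0−a¹_1)/2 · a²_1 · (a³_0−a³_1)/2⟩`,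
at least one of the following holds: there exists `q ∈ (0,1)` with `I/q + J/(1−q) ≤ 1`;
or `J = 0` and `I ≤ 1`; or `I = 0` and `J ≤ 1`. -/
theorem bilocal_quantifier_inequality
    {Λ₁ Λ₂ : Type} [MeasurableSpace Λ₁] [MeasurableSpace Λ₂]
    (ρ₁ : Measure Λ₁) (ρ₂ : Measure Λ₂)
    [IsProbabilityMeasure ρ₁] [IsProbabilityMeasure ρ₂]
    (a₁ : Fin 2 → Λ₁ → ℝ) (a₂ : Fin 2 → Λ₁ → Λ₂ → ℝ) (a₃ : Fin 2 → Λ₂ → ℝ)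
    (ha₁_meas : ∀ x, Measurable (a₁ x))
    (ha₂_meas : ∀ x, Measurable (fun p : Λ₁ × Λ₂ => a₂ x p.1 p.2))
    (ha₃_meas : ∀ x, Measurable (a₃ x))
    (ha₁_val : ∀ x l₁, a₁ x l₁ = 1 ∨ a₁ x l₁ = -1)
    (ha₂_val : ∀ x l₁ l₂, a₂ x l₁ l₂ = 1 ∨ a₂ x l₁ l₂ = -1)
    (ha₃_val : ∀ x l₂, a₃ x l₂ = 1 ∨ a₃ x l₂ = -1)
    (I J : ℝ)
    (hI : I = ∫ p, ((a₁ 0 p.1 + a₁ 1 p.1) / 2) * a₂ 0 p.1 p.2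
            * ((a₃ 0 p.2 + a₃ 1 p.2) / 2) ∂(ρ₁.prod ρ₂))
    (hJ : J = ∫ p, ((a₁ 0 p.1 - a₁ 1 p.1) / 2) * a₂ 1 p.1 p.2
            * ((a₃ 0 p.2 - a₃ 1 p.2) / 2) ∂(ρ₁.prod ρ₂)) :
    (∃ q ∈ Set.Ioo (0:ℝ) 1, I / q + J / (1 - q) ≤ 1)
      ∨ (J = 0 ∧ I ≤ 1) ∨ (I = 0 ∧ J ≤ 1) := by
  obtain ⟨hf, hf', hf_sum⟩ := integrable_half_add_sub_of_sign (μ := ρ₁)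
    (ha₁_meas 0) (ha₁_meas 1) (ha₁_val 0) (ha₁_val 1)
  obtain ⟨hg, hg', hg_sum⟩ := integrable_half_add_sub_of_sign (μ := ρ₂)
    (ha₃_meas 0) (ha₃_meas 1) (ha₃_val 0) (ha₃_val 1)
  have ha₂_abs : ∀ x l₁ l₂, |a₂ x l₁ l₂| ≤ 1 := fun x l₁ l₂ => by
    rcases ha₂_val x l₁ l₂ with h | h <;> simp [h]
  have hI_le := abs_integral_prod_mul_le hf hg (ha₂_abs 0)
  have hJ_le := abs_integral_prod_mul_le hf' hg' (ha₂_abs 1)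
  rw [← hI] at hI_le
  rw [← hJ] at hJ_le
  have hs : 0 ≤ ∫ x, |(a₁ 0 x + a₁ 1 x) / 2| ∂ρ₁ := integral_nonneg fun _ => abs_nonneg _
  have hs' : 0 ≤ ∫ x, |(a₁ 0 x - a₁ 1 x) / 2| ∂ρ₁ := integral_nonneg fun _ => abs_nonneg _
  have ht : 0 ≤ ∫ x, |(a₃ 0 x + a₃ 1 x) / 2| ∂ρ₂ := integral_nonneg fun _ => abs_nonneg _
  have ht' : 0 ≤ ∫ x, |(a₃ 0 x - a₃ 1 x) / 2| ∂ρ₂ := integral_nonneg fun _ => abs_nonneg _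
  generalize (∫ x, |(a₁ 0 x + a₁ 1 x) / 2| ∂ρ₁) = s at *
  generalize (∫ x, |(a₁ 0 x - a₁ 1 x) / 2| ∂ρ₁) = s' at *
  generalize (∫ x, |(a₃ 0 x + a₃ 1 x) / 2| ∂ρ₂) = t at *
  generalize (∫ x, |(a₃ 0 x - a₃ 1 x) / 2| ∂ρ₂) = t' at *
  obtain rfl : s' = 1 - s := by linarith
  obtain rfl : t' = 1 - t := by linarith
  rcases (by linarith : 0 ≤ (s + t) / 2).eq_or_lt with h0 | h0
  · obtain rfl : s = 0 := by linarith
    obtain rfl : t = 0 := by linarith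
    exact .inr <| .inr ⟨by simpa using hI_le, by linarith [le_abs_self J]⟩
  rcases (by linarith : (s + t) / 2 ≤ 1).eq_or_lt with h1 | h1
  · obtain rfl : s = 1 := by linarith
    obtain rfl : t = 1 := by linarith
    exact .inr <| .inl ⟨by simpa using hJ_le, by linarith [le_abs_self I]⟩
  refine .inl ⟨(s + t) / 2, ⟨h0, h1⟩, ?_⟩
  have hIq : I / ((s + t) / 2) ≤ (s + t) / 2 := by
    rw [div_le_iff₀ h0]
    nlinarith [le_abs_self I, sq_nonneg (s - t)]
  have hJq : J / (1 - (s + t) / 2) ≤ 1 - (s + t) / 2 := by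
    rw [div_le_iff₀ (by linarith)]
    nlinarith [le_abs_self J, sq_nonneg (s - t)]
  linarith
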